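/- arXiv:2405.14099 — 4 statements merged into one kernel-verified Lean document; each statement's English description precedes it below -/
import Mathlib

section
/- Let A₀ and A₂ be real N×M matrices with N ≥ M, let C₂ be a real symmetric positive definite N×N matrix, and let D₂ be a real M×M diagonal matrix with positive diagonal entries (hence invertible). Define A_FD = C₂ A₀ and A_AD = A₂ D₂. Assume σ_min(A₂) ≠ 0 and that C := σ_min(A₀)/σ_min(A₂) satisfies C ≥ 1/(λ_min(C₂) · λ_min(D₂⁻¹)). Then σ_min(A_FD) ≥ σ_min(A_AD). -/
open Matrix

/-- The smallest eigenvalue of a real symmetric matrix, as the infimum of its real spectrum. -/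
noncomputable def lambdaMin {n : ℕ} (A : Matrix (Fin n) (Fin n) ℝ) : ℝ :=
  sInf (spectrum ℝ A)

/-- The smallest singular value of a real `N × M` matrix: the square root of the smallest
eigenvalue of `Aᵀ * A`. -/
noncomputable def sigmaMin {N M : ℕ} (A : Matrix (Fin N) (Fin M) ℝ) : ℝ :=
  Real.sqrt (sInf (spectrum ℝ (Aᵀ * A)))

theorem sInf_spectrum_mem {n : ℕ} [NeZero n] {S : Matrix (Fin n) (Fin n) ℝ}
    (hS : S.IsHermitian) : sInf (spectrum ℝ S) ∈ spectrum ℝ S := by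
  have h := hS.spectrum_real_eq_range_eigenvalues
  refine Set.Nonempty.csInf_mem ?_ ?_
  · rw [h]
    exact Set.range_nonempty _
  · rw [h]
    exact Set.finite_range _

theorem exists_mulVec_eq_sInf_spectrum_smul {n : ℕ} [NeZero n] {S : Matrix (Fin n) (Fin n) ℝ}
    (hS : S.IsHermitian) : ∃ v ≠ 0, S *ᵥ v = sInf (spectrum ℝ S) • v := by
  have h := sInf_spectrum_mem hS
  rw [← Matrix.spectrum_toLin', ← Module.End.hasEigenvalue_iff_mem_spectrum] at h
  obtain ⟨v, hv⟩ := h.exists_hasEigenvector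
  refine ⟨v, hv.2, ?_⟩
  have := hv.apply_eq_smul
  rwa [Matrix.toLin'_apply, Matrix.spectrum_toLin'] at this

theorem sInf_spectrum_mul_dotProduct_le {n : ℕ} {S : Matrix (Fin n) (Fin n) ℝ}
    (hS : S.IsHermitian) (x : Fin n → ℝ) :
    sInf (spectrum ℝ S) * (x ⬝ᵥ x) ≤ x ⬝ᵥ (S *ᵥ x) := by
  set m := sInf (spectrum ℝ S) with hm
  have hT : (S - m • (1 : Matrix (Fin n) (Fin n) ℝ)).IsHermitian :=
    hS.sub (by simp [Matrix.IsHermitian])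
  have hpos : (S - m • (1 : Matrix (Fin n) (Fin n) ℝ)).PosSemidef := by
    rw [hT.posSemidef_iff_eigenvalues_nonneg]
    intro i
    have hi : hT.eigenvalues i ∈ spectrum ℝ (S - m • (1 : Matrix (Fin n) (Fin n) ℝ)) := by
      rw [hT.spectrum_real_eq_range_eigenvalues]
      exact ⟨i, rfl⟩
    have hi' : hT.eigenvalues i + m ∈ spectrum ℝ S := by
      rw [spectrum.add_mem_iff, neg_add_eq_sub, Algebra.algebraMap_eq_smul_one]
      exact hi
    have hbdd : BddBelow (spectrum ℝ S) := by
      rw [hS.spectrum_real_eq_range_eigenvalues]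
      exact (Set.finite_range _).bddBelow
    have := csInf_le hbdd hi'
    simp only [Pi.zero_apply]
    linarith
  have h := hpos.dotProduct_mulVec_nonneg x
  simp only [star_trivial, Matrix.sub_mulVec, Matrix.smul_mulVec, Matrix.one_mulVec,
    dotProduct_sub, dotProduct_smul, smul_eq_mul] at h
  linarith

theorem lambdaMin_pos {n : ℕ} [NeZero n] {S : Matrix (Fin n) (Fin n) ℝ}
    (hS : S.PosDef) : 0 < lambdaMin S := by
  have h := sInf_spectrum_mem hS.isHermitian
  rw [hS.isHermitian.spectrum_real_eq_range_eigenvalues] at h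
  obtain ⟨i, hi⟩ := h
  rw [lambdaMin, hS.isHermitian.spectrum_real_eq_range_eigenvalues, ← hi]
  exact hS.eigenvalues_pos i

theorem lambdaMin_sq_mul_dotProduct_le {n : ℕ} [NeZero n] {S : Matrix (Fin n) (Fin n) ℝ}
    (hS : S.PosDef) (x : Fin n → ℝ) :
    lambdaMin S ^ 2 * (x ⬝ᵥ x) ≤ (S *ᵥ x) ⬝ᵥ (S *ᵥ x) := by
  have h1 : lambdaMin S * (x ⬝ᵥ x) ≤ x ⬝ᵥ (S *ᵥ x) :=
    sInf_spectrum_mul_dotProduct_le hS.isHermitian x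
  have h2 : 0 ≤ (S *ᵥ x - lambdaMin S • x) ⬝ᵥ (S *ᵥ x - lambdaMin S • x) :=
    dotProduct_self_star_nonneg _
  simp only [dotProduct_sub, sub_dotProduct, dotProduct_smul, smul_dotProduct, smul_eq_mul,
    dotProduct_comm (S *ᵥ x) x] at h2
  nlinarith [mul_le_mul_of_nonneg_left h1 (lambdaMin_pos hS).le]

theorem dotProduct_transpose_mul_self_mulVec {N M : ℕ} (A : Matrix (Fin N) (Fin M) ℝ)
    (x : Fin M → ℝ) : x ⬝ᵥ ((Aᵀ * A) *ᵥ x) = (A *ᵥ x) ⬝ᵥ (A *ᵥ x) := by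
  rw [← Matrix.mulVec_mulVec, Matrix.dotProduct_mulVec, Matrix.vecMul_transpose]

theorem posSemidef_transpose_mul_self {N M : ℕ} (A : Matrix (Fin N) (Fin M) ℝ) :
    (Aᵀ * A).PosSemidef := by
  simpa [Matrix.conjTranspose_eq_transpose_of_trivial] using
    Matrix.posSemidef_conjTranspose_mul_self A

theorem sigmaMin_sq {N M : ℕ} (A : Matrix (Fin N) (Fin M) ℝ) :
    sigmaMin A ^ 2 = sInf (spectrum ℝ (Aᵀ * A)) := by
  have hA := posSemidef_transpose_mul_self A
  refine Real.sq_sqrt (Real.sInf_nonneg fun r hr => ?_)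
  rw [hA.isHermitian.spectrum_real_eq_range_eigenvalues] at hr
  obtain ⟨i, rfl⟩ := hr
  exact hA.eigenvalues_nonneg i

theorem sigmaMin_sq_mul_dotProduct_le {N M : ℕ} (A : Matrix (Fin N) (Fin M) ℝ)
    (x : Fin M → ℝ) : sigmaMin A ^ 2 * (x ⬝ᵥ x) ≤ (A *ᵥ x) ⬝ᵥ (A *ᵥ x) := by
  rw [sigmaMin_sq, ← dotProduct_transpose_mul_self_mulVec]
  exact sInf_spectrum_mul_dotProduct_le (posSemidef_transpose_mul_self A).isHermitian x

theorem exists_dotProduct_eq_sigmaMin_sq_mul {N M : ℕ} [NeZero M]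
    (A : Matrix (Fin N) (Fin M) ℝ) :
    ∃ v ≠ 0, (A *ᵥ v) ⬝ᵥ (A *ᵥ v) = sigmaMin A ^ 2 * (v ⬝ᵥ v) := by
  obtain ⟨v, hv, h⟩ :=
    exists_mulVec_eq_sInf_spectrum_smul (posSemidef_transpose_mul_self A).isHermitian
  refine ⟨v, hv, ?_⟩
  rw [← dotProduct_transpose_mul_self_mulVec, h, sigmaMin_sq, dotProduct_smul, smul_eq_mul]

theorem sigmaMin_nonneg {N M : ℕ} (A : Matrix (Fin N) (Fin M) ℝ) : 0 ≤ sigmaMin A :=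
  Real.sqrt_nonneg _

theorem dotProduct_self_pos_of_ne_zero {n : ℕ} {v : Fin n → ℝ} (hv : v ≠ 0) : 0 < v ⬝ᵥ v :=
  Matrix.dotProduct_self_star_pos_iff.mpr hv

theorem lambdaMin_mul_sigmaMin_le {N M : ℕ} [NeZero N] [NeZero M]
    {S : Matrix (Fin N) (Fin N) ℝ} (hS : S.PosDef) (A : Matrix (Fin N) (Fin M) ℝ) :
    lambdaMin S * sigmaMin A ≤ sigmaMin (S * A) := by
  obtain ⟨v, hv, h⟩ := exists_dotProduct_eq_sigmaMin_sq_mul (S * A)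
  refine le_of_pow_le_pow_left₀ two_ne_zero (sigmaMin_nonneg _) ?_
  refine le_of_mul_le_mul_right ?_ (dotProduct_self_pos_of_ne_zero hv)
  rw [← h, ← Matrix.mulVec_mulVec, mul_pow, mul_assoc]
  exact (mul_le_mul_of_nonneg_left (sigmaMin_sq_mul_dotProduct_le A v) (sq_nonneg _)).trans
    (lambdaMin_sq_mul_dotProduct_le hS _)

theorem sigmaMin_mul_lambdaMin_inv_le {N M : ℕ} [NeZero M]
    {D : Matrix (Fin M) (Fin M) ℝ} (hD : D.PosDef) (A : Matrix (Fin N) (Fin M) ℝ) :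
    sigmaMin (A * D) * lambdaMin D⁻¹ ≤ sigmaMin A := by
  obtain ⟨v, hv, h⟩ := exists_dotProduct_eq_sigmaMin_sq_mul A
  have hdet : IsUnit D.det := hD.det_pos.ne'.isUnit
  refine le_of_pow_le_pow_left₀ two_ne_zero (sigmaMin_nonneg _) ?_
  refine le_of_mul_le_mul_right ?_ (dotProduct_self_pos_of_ne_zero hv)
  have h1 := sigmaMin_sq_mul_dotProduct_le (A * D) (D⁻¹ *ᵥ v)
  rw [Matrix.mulVec_mulVec, Matrix.mul_assoc, Matrix.mul_nonsing_inv _ hdet, Matrix.mul_one,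
    h] at h1
  rw [mul_pow, mul_assoc]
  exact (mul_le_mul_of_nonneg_left (lambdaMin_sq_mul_dotProduct_le hD.inv v)
    (sq_nonneg _)).trans h1

theorem stmt1 {N M : ℕ} (hNM : M ≤ N)
    (A0 A2 : Matrix (Fin N) (Fin M) ℝ)
    (C2 : Matrix (Fin N) (Fin N) ℝ) (hC2 : C2.PosDef)
    (d : Fin M → ℝ) (hd : ∀ i, 0 < d i)
    (D2 : Matrix (Fin M) (Fin M) ℝ) (hD2 : D2 = Matrix.diagonal d)
    (AFD AAD : Matrix (Fin N) (Fin M) ℝ)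
    (hAFD : AFD = C2 * A0) (hAAD : AAD = A2 * D2)
    (hA2 : sigmaMin A2 ≠ 0)
    (C : ℝ) (hC : C = sigmaMin A0 / sigmaMin A2)
    (hCge : 1 / (lambdaMin C2 * lambdaMin D2⁻¹) ≤ C) :
    sigmaMin AAD ≤ sigmaMin AFD := by
  have hM : NeZero M := ⟨by
    rintro rfl
    exact hA2 (by simp [sigmaMin, spectrum.of_subsingleton])⟩
  have hN : NeZero N := ⟨fun h => NeZero.ne M (by omega)⟩
  have hD : D2.PosDef := hD2 ▸ Matrix.PosDef.diagonal hd
  subst hAFD hAAD hC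
  have hσ : 0 < sigmaMin A2 := (sigmaMin_nonneg A2).lt_of_ne' hA2
  have hl := lambdaMin_pos hC2
  have hm := lambdaMin_pos hD.inv
  rw [div_le_div_iff₀ (mul_pos hl hm) hσ, one_mul] at hCge
  refine le_of_mul_le_mul_right ?_ hm
  calc sigmaMin (A2 * D2) * lambdaMin D2⁻¹ ≤ sigmaMin A2 := sigmaMin_mul_lambdaMin_inv_le hD A2
    _ ≤ lambdaMin C2 * sigmaMin A0 * lambdaMin D2⁻¹ := hCge.trans_eq (by ring)
    _ ≤ sigmaMin (C2 * A0) * lambdaMin D2⁻¹ :=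
      mul_le_mul_of_nonneg_right (lambdaMin_mul_sigmaMin_le hC2 A0) hm.le
end

section
/- Let I be a nonempty finite index set, let t* < T be real numbers, let λ : [t*,T] → I → ℝ be nonnegative, and let r : [t*,T] → I → ℝ with r_i(t)² > 0 for all i ∈ I and t ∈ [t*,T]. Suppose L : [t*,T] → ℝ is differentiable, L(t) = Σ_{i∈I} r_i(t)², and L'(t) = −2 Σ_{i∈I} λ_i(t) r_i(t)² for all t ∈ [t*,T]. Define η(T) = min over t ∈ [t*,T] of (min_{i∈I} r_i(t)²)/(max_{i∈I} r_i(t)²), and m = min over t ∈ [t*,T] of (Σ_{i∈I} λ_i(t))/|I|. Then for all t ∈ [t*,T], L(t) ≤ exp(−2 η(T) · m · (t − t*)) · L(t*). -/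
open Set

/-- Grönwall's inequality on a closed interval, for one-sided derivatives at the endpoints. -/
theorem le_exp_mul_of_hasDerivWithinAt_le {f f' : ℝ → ℝ} {a b c : ℝ}
    (hf : ∀ t ∈ Icc a b, HasDerivWithinAt f (f' t) (Icc a b) t)
    (hle : ∀ t ∈ Icc a b, f' t ≤ c * f t) {t : ℝ} (ht : t ∈ Icc a b) :
    f t ≤ Real.exp (c * (t - a)) * f a := by
  have hexp (s : ℝ) : HasDerivAt (fun s => Real.exp (-(c * (s - a))))
      (Real.exp (-(c * (s - a))) * -(c * 1)) s :=
    ((((hasDerivAt_id s).sub_const a).const_mul c).neg).exp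
  have hder : ∀ s ∈ Icc a b, HasDerivWithinAt (fun s => Real.exp (-(c * (s - a))) * f s)
      (Real.exp (-(c * (s - a))) * -(c * 1) * f s + Real.exp (-(c * (s - a))) * f' s)
      (Icc a b) s := fun s hs => (hexp s).hasDerivWithinAt.mul (hf s hs)
  have hanti : AntitoneOn (fun s => Real.exp (-(c * (s - a))) * f s) (Icc a b) := by
    refine antitoneOn_of_hasDerivWithinAt_nonpos (convex_Icc a b)
      (fun s hs => (hder s hs).continuousWithinAt)
      (fun s hs => (hder s (interior_subset hs)).mono interior_subset) fun s hs => ?_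
    nlinarith [mul_le_mul_of_nonneg_left (hle s (interior_subset hs))
      (Real.exp_pos (-(c * (s - a)))).le]
  have h := hanti (left_mem_Icc.2 (ht.1.trans ht.2)) ht ht.1
  simp only [sub_self, mul_zero, neg_zero, Real.exp_zero, one_mul] at h
  calc f t = Real.exp (c * (t - a)) * (Real.exp (-(c * (t - a))) * f t) := by
        rw [← mul_assoc, ← Real.exp_add, add_neg_cancel, Real.exp_zero, one_mul]
    _ ≤ _ := mul_le_mul_of_nonneg_left h (Real.exp_pos _).le

/-- A weighted sum of positive reals is bounded below through the min-max ratio of the terms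
and the mean weight. -/
theorem mul_sum_le_sum_mul_of_le_iInf_div_iSup {ι : Type*} [Fintype ι] [Nonempty ι]
    {w x : ι → ℝ} {η m : ℝ} (hw : ∀ i, 0 ≤ w i) (hx : ∀ i, 0 < x i) (hη₀ : 0 ≤ η) (hm₀ : 0 ≤ m)
    (hη : η ≤ (⨅ i, x i) / ⨆ i, x i) (hm : m ≤ (∑ i, w i) / (Fintype.card ι : ℝ)) :
    η * m * ∑ i, x i ≤ ∑ i, w i * x i := by
  have hsup (i : ι) : x i ≤ ⨆ j, x j := le_ciSup (Set.finite_range x).bddAbove i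
  have hinf (i : ι) : ⨅ j, x j ≤ x i := ciInf_le (Set.finite_range x).bddBelow i
  have hpos : 0 < ⨆ j, x j := (hx (Classical.arbitrary ι)).trans_le (hsup _)
  rw [le_div_iff₀ hpos] at hη
  rw [le_div_iff₀ (by exact_mod_cast Fintype.card_pos)] at hm
  have hsum : ∑ i, x i ≤ Fintype.card ι * ⨆ j, x j := by
    simpa using Finset.sum_le_card_nsmul Finset.univ x _ fun i _ => hsup i
  calc η * m * ∑ i, x i ≤ η * m * (Fintype.card ι * ⨆ j, x j) := by gcongr
    _ = (m * Fintype.card ι) * (η * ⨆ j, x j) := by ring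
    _ ≤ (∑ i, w i) * ⨅ j, x j :=
        mul_le_mul hm hη (by positivity) (Finset.sum_nonneg fun i _ => hw i)
    _ = ∑ i, w i * ⨅ j, x j := Finset.sum_mul ..
    _ ≤ ∑ i, w i * x i :=
        Finset.sum_le_sum fun i _ => mul_le_mul_of_nonneg_left (hinf i) (hw i)

theorem stmt2 {ι : Type} [Fintype ι] [Nonempty ι]
    (tstar T : ℝ) (htT : tstar < T)
    (lam r : ℝ → ι → ℝ)
    (hlam : ∀ t ∈ Icc tstar T, ∀ i, 0 ≤ lam t i)
    (hr : ∀ t ∈ Icc tstar T, ∀ i, 0 < (r t i) ^ 2)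
    (L : ℝ → ℝ)
    (hL : ∀ t ∈ Icc tstar T, L t = ∑ i, (r t i) ^ 2)
    (hL' : ∀ t ∈ Icc tstar T,
      HasDerivWithinAt L (-2 * ∑ i, lam t i * (r t i) ^ 2) (Icc tstar T) t)
    (η m : ℝ)
    (hη : IsLeast ((fun t => (⨅ i, (r t i) ^ 2) / (⨆ i, (r t i) ^ 2)) '' Icc tstar T) η)
    (hm : IsLeast ((fun t => (∑ i, lam t i) / (Fintype.card ι : ℝ)) '' Icc tstar T) m) :
    ∀ t ∈ Icc tstar T, L t ≤ Real.exp (-2 * η * m * (t - tstar)) * L tstar := by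
  have hη₀ : 0 ≤ η := by
    obtain ⟨s, -, rfl⟩ := hη.1
    exact div_nonneg (Real.iInf_nonneg fun i => sq_nonneg _)
      (Real.iSup_nonneg fun i => sq_nonneg _)
  have hm₀ : 0 ≤ m := by
    obtain ⟨s, hs, rfl⟩ := hm.1
    exact div_nonneg (Finset.sum_nonneg fun i _ => hlam s hs i) (Nat.cast_nonneg _)
  refine fun t ht => le_exp_mul_of_hasDerivWithinAt_le hL' (fun s hs => ?_) ht
  have h := mul_sum_le_sum_mul_of_le_iInf_div_iSup (hlam s hs) (hr s hs) hη₀ hm₀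
    (hη.2 (mem_image_of_mem _ hs)) (hm.2 (mem_image_of_mem _ hs))
  rw [hL s hs]
  linarith
end

section
/- Let I be a nonempty finite index set, let t* < T be real numbers, let λ : [t*,T] → I → ℝ be nonnegative, and let r : [t*,T] → I → ℝ with r_i(t)² > 0 for all i ∈ I and t ∈ [t*,T]. Suppose L : [t*,T] → ℝ is differentiable, L(t) = Σ_{i∈I} r_i(t)², and L'(t) = −2 Σ_{i∈I} λ_i(t) r_i(t)² for all t ∈ [t*,T]. Define ζ(T) = max over t ∈ [t*,T] of (max_{i∈I} r_i(t)²)/(min_{i∈I} r_i(t)²), and M = max over t ∈ [t*,T] of (Σ_{i∈I} λ_i(t))/|I|. Then for all t ∈ [t*,T], L(t) ≥ exp(−2 ζ(T) · M · (t − t*)) · L(t*). -/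
open Set

/-- A weighted sum is at most the mean weight times the total, up to the ratio of the largest to
the smallest entry. -/
theorem sum_mul_le_iSup_div_iInf_mul {ι : Type*} [Fintype ι] [Nonempty ι] (w x : ι → ℝ)
    (hw : ∀ i, 0 ≤ w i) (hx : ∀ i, 0 < x i) :
    ∑ i, w i * x i ≤
      ((⨆ i, x i) / ⨅ i, x i) * ((∑ i, w i) / (Fintype.card ι : ℝ)) * ∑ i, x i := by
  have hn : (0 : ℝ) < Fintype.card ι := by exact_mod_cast Fintype.card_pos
  have hsup (i : ι) : x i ≤ ⨆ j, x j := le_ciSup (Set.finite_range x).bddAbove i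
  have hinf (i : ι) : ⨅ j, x j ≤ x i := ciInf_le (Set.finite_range x).bddBelow i
  have hinf_pos : 0 < ⨅ j, x j := by
    obtain ⟨i, hi⟩ := exists_eq_ciInf_of_finite (f := x)
    exact hi ▸ hx i
  have hsup_nonneg : 0 ≤ ⨆ j, x j := Real.iSup_nonneg fun i => (hx i).le
  have hw_sum : 0 ≤ ∑ i, w i := Finset.sum_nonneg fun i _ => hw i
  have hcard : (Fintype.card ι : ℝ) * ⨅ j, x j ≤ ∑ i, x i := by
    simpa using Finset.card_nsmul_le_sum Finset.univ x _ fun i _ => hinf i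
  calc ∑ i, w i * x i ≤ ∑ i, w i * ⨆ j, x j :=
        Finset.sum_le_sum fun i _ => mul_le_mul_of_nonneg_left (hsup i) (hw i)
    _ = ((⨆ i, x i) / ⨅ i, x i) * ((∑ i, w i) / (Fintype.card ι : ℝ)) *
          ((Fintype.card ι : ℝ) * ⨅ j, x j) := by
        rw [← Finset.sum_mul]
        field_simp
    _ ≤ _ := mul_le_mul_of_nonneg_left hcard (by positivity)

/-- Grönwall's inequality from below: if `f' ≥ -c f` on `[a, b]`, then
`f t ≥ exp (-c (t - a)) f a`. -/
theorem exp_mul_le_of_hasDerivWithinAt_ge {a b c : ℝ} {f f' : ℝ → ℝ}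
    (hf : ∀ t ∈ Icc a b, HasDerivWithinAt f (f' t) (Icc a b) t)
    (hf' : ∀ t ∈ Icc a b, -c * f t ≤ f' t) {t : ℝ} (ht : t ∈ Icc a b) :
    Real.exp (-c * (t - a)) * f a ≤ f t := by
  have hderiv : ∀ s ∈ Icc a b, HasDerivWithinAt (fun s => Real.exp (c * (s - a)) * f s)
      (Real.exp (c * (s - a)) * (c * 1) * f s + Real.exp (c * (s - a)) * f' s) (Icc a b) s :=
    fun s hs => ((((hasDerivAt_id s).sub_const a).const_mul c).exp.hasDerivWithinAt).mul (hf s hs)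
  have hmono : MonotoneOn (fun s => Real.exp (c * (s - a)) * f s) (Icc a b) := by
    refine monotoneOn_of_hasDerivWithinAt_nonneg (convex_Icc a b)
      (fun s hs => (hderiv s hs).continuousWithinAt)
      (fun s hs => (hderiv s (interior_subset hs)).mono interior_subset) fun s hs => ?_
    have := mul_nonneg (Real.exp_pos (c * (s - a))).le
      (sub_nonneg.2 (hf' s (interior_subset hs)))
    linarith
  have hle := hmono (left_mem_Icc.2 (ht.1.trans ht.2)) ht ht.1
  simp only [sub_self, mul_zero, Real.exp_zero, one_mul] at hle
  calc Real.exp (-c * (t - a)) * f a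
      ≤ Real.exp (-c * (t - a)) * (Real.exp (c * (t - a)) * f t) :=
        mul_le_mul_of_nonneg_left hle (Real.exp_pos _).le
    _ = f t := by rw [← mul_assoc, ← Real.exp_add]; simp

theorem stmt3 {ι : Type} [Fintype ι] [Nonempty ι]
    (tstar T : ℝ) (htT : tstar < T)
    (lam r : ℝ → ι → ℝ)
    (hlam : ∀ t ∈ Icc tstar T, ∀ i, 0 ≤ lam t i)
    (hr : ∀ t ∈ Icc tstar T, ∀ i, 0 < (r t i) ^ 2)
    (L : ℝ → ℝ)
    (hL : ∀ t ∈ Icc tstar T, L t = ∑ i, (r t i) ^ 2)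
    (hL' : ∀ t ∈ Icc tstar T,
      HasDerivWithinAt L (-2 * ∑ i, lam t i * (r t i) ^ 2) (Icc tstar T) t)
    (ζ Mbig : ℝ)
    (hζ : IsGreatest ((fun t => (⨆ i, (r t i) ^ 2) / (⨅ i, (r t i) ^ 2)) '' Icc tstar T) ζ)
    (hM : IsGreatest ((fun t => (∑ i, lam t i) / (Fintype.card ι : ℝ)) '' Icc tstar T) Mbig) :
    ∀ t ∈ Icc tstar T, Real.exp (-2 * ζ * Mbig * (t - tstar)) * L tstar ≤ L t := by
  intro t ht
  have hbound : ∀ s ∈ Icc tstar T,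
      -(2 * ζ * Mbig) * L s ≤ -2 * ∑ i, lam s i * (r s i) ^ 2 := by
    intro s hs
    have hratio : (⨆ i, (r s i) ^ 2) / (⨅ i, (r s i) ^ 2) ≤ ζ := hζ.2 ⟨s, hs, rfl⟩
    have hmean : (∑ i, lam s i) / (Fintype.card ι : ℝ) ≤ Mbig := hM.2 ⟨s, hs, rfl⟩
    have hratio_nonneg : 0 ≤ (⨆ i, (r s i) ^ 2) / (⨅ i, (r s i) ^ 2) :=
      div_nonneg (Real.iSup_nonneg fun i => sq_nonneg _) (Real.iInf_nonneg fun i => sq_nonneg _)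
    have hmean_nonneg : 0 ≤ (∑ i, lam s i) / (Fintype.card ι : ℝ) :=
      div_nonneg (Finset.sum_nonneg fun i _ => hlam s hs i) (Nat.cast_nonneg _)
    have hprod := mul_le_mul hratio hmean hmean_nonneg (hratio_nonneg.trans hratio)
    have hsum := (sum_mul_le_iSup_div_iInf_mul (lam s) (fun i => (r s i) ^ 2)
      (hlam s hs) (hr s hs)).trans
      (mul_le_mul_of_nonneg_right hprod (Finset.sum_nonneg fun i _ => sq_nonneg (r s i)))
    rw [← hL s hs] at hsum
    linarith
  simpa only [neg_mul] using exp_mul_le_of_hasDerivWithinAt_ge hL' hbound ht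
end

section
/- Let h > 0, let x ∈ ℝ, and let f : ℝ → ℝ be six times continuously differentiable on [x − 2h, x + 2h] with |f⁽⁶⁾(y)| ≤ K for all y ∈ [x − 2h, x + 2h]. Then |(−f(x − 2h) + 16 f(x − h) − 30 f(x) + 16 f(x + h) − f(x + 2h))/(12 h²) − f''(x)| ≤ K h⁴/90. -/
open Set

/-- Integrating a monomial bound on the derivative of a function vanishing at `0`. -/
theorem abs_le_mul_pow_succ_of_hasDerivWithinAt {φ φ' : ℝ → ℝ} {h C : ℝ} (n : ℕ)
    (hd : ∀ t ∈ Icc 0 h, HasDerivWithinAt φ (φ' t) (Icc 0 h) t) (h0 : φ 0 = 0)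
    (hb : ∀ t ∈ Icc 0 h, |φ' t| ≤ C * t ^ n) :
    ∀ t ∈ Icc 0 h, |φ t| ≤ C / (n + 1) * t ^ (n + 1) := by
  intro t ht
  have hB : ∀ s : ℝ, HasDerivAt (fun s : ℝ ↦ C / (n + 1) * s ^ (n + 1)) (C * s ^ n) s := by
    intro s
    have hn : (n : ℝ) + 1 ≠ 0 := by positivity
    refine ((hasDerivAt_pow (n + 1) s).const_mul (C / ((n : ℝ) + 1))).congr_deriv ?_
    rw [Nat.add_sub_cancel]
    push_cast
    field_simp
  refine image_norm_le_of_norm_deriv_right_le_deriv_boundary (f := φ) (f' := φ')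
    (fun s hs ↦ (hd s hs).continuousWithinAt) (fun s hs ↦ ?_) (by simp [h0]) hB
    (fun s hs ↦ hb s (Ico_subset_Icc_self hs)) ht
  exact (hd s (Ico_subset_Icc_self hs)).mono_of_mem_nhdsWithin (Icc_mem_nhdsGE_of_mem hs)

theorem stmt11 (h x K : ℝ) (hh : 0 < h) (f : ℝ → ℝ)
    (hf : ContDiffOn ℝ 6 f (Icc (x - 2 * h) (x + 2 * h)))
    (hK : ∀ y ∈ Icc (x - 2 * h) (x + 2 * h),
      |iteratedDerivWithin 6 f (Icc (x - 2 * h) (x + 2 * h)) y| ≤ K) :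
    |(-f (x - 2 * h) + 16 * f (x - h) - 30 * f x + 16 * f (x + h) - f (x + 2 * h)) /
          (12 * h ^ 2) -
        iteratedDerivWithin 2 f (Icc (x - 2 * h) (x + 2 * h)) x| ≤ K * h ^ 4 / 90 := by
  set I := Icc (x - 2 * h) (x + 2 * h) with hI
  have hu : UniqueDiffOn ℝ I := uniqueDiffOn_Icc (by linarith)
  obtain ⟨D, hD⟩ : ∃ D : ℕ → ℝ → ℝ, D = fun k ↦ iteratedDerivWithin k f I := ⟨_, rfl⟩
  have hD0 : ∀ y, f y = D 0 y := by simp [hD]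
  have hDd : ∀ k < 6, ∀ y ∈ I, HasDerivWithinAt (D k) (D (k + 1) y) I y := by
    intro k hk y hy
    have h1 : DifferentiableOn ℝ (iteratedDerivWithin k f I) I :=
      hf.differentiableOn_iteratedDerivWithin (by exact_mod_cast hk) hu
    have h2 := (h1 y hy).hasDerivWithinAt
    rw [← iteratedDerivWithin_succ] at h2
    rw [hD]
    exact h2
  have hDK : ∀ y ∈ I, |D 6 y| ≤ K := by rw [hD]; exact hK
  have hgoal : iteratedDerivWithin 2 f I x = D 2 x := by rw [hD]
  rw [hgoal]
  simp only [hD0]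
  clear hgoal hK
  have hmem : ∀ c : ℝ, |c| ≤ 2 → ∀ t ∈ Icc 0 h, x + c * t ∈ I := by
    intro c hc t ht
    obtain ⟨hc1, hc2⟩ := abs_le.mp hc
    obtain ⟨ht1, ht2⟩ := ht
    constructor <;> nlinarith
  have hcomp : ∀ k < 6, ∀ c : ℝ, |c| ≤ 2 → ∀ t ∈ Icc 0 h,
      HasDerivWithinAt (fun t ↦ D k (x + c * t)) (c * D (k + 1) (x + c * t)) (Icc 0 h) t := by
    intro k hk c hc t ht
    have h1 : HasDerivWithinAt (fun t : ℝ ↦ x + c * t) c (Icc 0 h) t := by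
      simpa using (((hasDerivAt_id t).const_mul c).const_add x).hasDerivWithinAt
    have h2 := (hDd k hk _ (hmem c hc t ht)).comp t h1 (hmem c hc)
    rw [mul_comm] at h2
    exact h2
  have hp1 : |(1 : ℝ)| ≤ 2 := by norm_num
  have hm1 : |(-1 : ℝ)| ≤ 2 := by norm_num
  have hp2 : |(2 : ℝ)| ≤ 2 := by norm_num
  have hm2 : |(-2 : ℝ)| ≤ 2 := by norm_num
  have hstencil : ∀ k < 6, ∀ a b c d : ℝ, ∀ t ∈ Icc 0 h,
      HasDerivWithinAt (fun t ↦ a * D k (x + 1 * t) + b * D k (x + -1 * t)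
          + c * D k (x + 2 * t) + d * D k (x + -2 * t))
        (a * D (k + 1) (x + 1 * t) + -b * D (k + 1) (x + -1 * t)
          + 2 * c * D (k + 1) (x + 2 * t) + -2 * d * D (k + 1) (x + -2 * t)) (Icc 0 h) t := by
    intro k hk a b c d t ht
    refine (((((hcomp k hk 1 hp1 t ht).const_mul a).add
      ((hcomp k hk (-1) hm1 t ht).const_mul b)).add
      ((hcomp k hk 2 hp2 t ht).const_mul c)).add
      ((hcomp k hk (-2) hm2 t ht).const_mul d)).congr_deriv ?_
    ring
  have hlip : ∀ y ∈ I, ∀ z ∈ I, |D 5 z - D 5 y| ≤ K * |z - y| := fun y hy z hz ↦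
    (convex_Icc _ _).norm_image_sub_le_of_norm_hasDerivWithin_le
      (fun w hw ↦ hDd 5 (by norm_num) w hw) hDK hy hz
  have b5 : ∀ t ∈ Icc 0 h, |16 * D 5 (x + 1 * t) + -16 * D 5 (x + -1 * t)
      + -32 * D 5 (x + 2 * t) + 32 * D 5 (x + -2 * t)| ≤ 96 * K * t ^ 1 := by
    intro t ht
    have e1 := hlip _ (hmem (-1) hm1 t ht) _ (hmem 1 hp1 t ht)
    have e2 := hlip _ (hmem 1 hp1 t ht) _ (hmem 2 hp2 t ht)
    have e3 := hlip _ (hmem (-2) hm2 t ht) _ (hmem (-1) hm1 t ht)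
    rw [show x + 1 * t - (x + -1 * t) = 2 * t by ring,
      abs_of_nonneg (by linarith [ht.1] : 0 ≤ 2 * t)] at e1
    rw [show x + 2 * t - (x + 1 * t) = t by ring, abs_of_nonneg ht.1] at e2
    rw [show x + -1 * t - (x + -2 * t) = t by ring, abs_of_nonneg ht.1] at e3
    rw [abs_le] at *
    constructor <;> linarith
  have b4 := abs_le_mul_pow_succ_of_hasDerivWithinAt
    (φ := fun t ↦ 16 * D 4 (x + 1 * t) + 16 * D 4 (x + -1 * t)
      + -16 * D 4 (x + 2 * t) + -16 * D 4 (x + -2 * t)) 1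
    (fun t ht ↦ (hstencil 4 (by norm_num) 16 16 (-16) (-16) t ht).congr_deriv (by ring))
    (by simp only [mul_zero, add_zero]; ring) b5
  have b3 := abs_le_mul_pow_succ_of_hasDerivWithinAt
    (φ := fun t ↦ 16 * D 3 (x + 1 * t) + -16 * D 3 (x + -1 * t)
      + -8 * D 3 (x + 2 * t) + 8 * D 3 (x + -2 * t)) _
    (fun t ht ↦ (hstencil 3 (by norm_num) 16 (-16) (-8) 8 t ht).congr_deriv (by ring))
    (by simp only [mul_zero, add_zero]; ring) b4
  have b2 := abs_le_mul_pow_succ_of_hasDerivWithinAt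
    (φ := fun t ↦ 16 * D 2 (x + 1 * t) + 16 * D 2 (x + -1 * t)
      + -4 * D 2 (x + 2 * t) + -4 * D 2 (x + -2 * t) - 24 * D 2 x) _
    (fun t ht ↦ ((hstencil 2 (by norm_num) 16 16 (-4) (-4) t ht).sub_const _).congr_deriv
      (by ring))
    (by simp only [mul_zero, add_zero]; ring) b3
  have b1 := abs_le_mul_pow_succ_of_hasDerivWithinAt
    (φ := fun t ↦ 16 * D 1 (x + 1 * t) + -16 * D 1 (x + -1 * t)
      + -2 * D 1 (x + 2 * t) + 2 * D 1 (x + -2 * t) - 24 * D 2 x * t) _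
    (fun t ht ↦ ((hstencil 1 (by norm_num) 16 (-16) (-2) 2 t ht).sub
      ((hasDerivWithinAt_id t _).const_mul (24 * D 2 x))).congr_deriv (by ring))
    (by simp only [mul_zero, add_zero]; ring) b2
  have b0 := abs_le_mul_pow_succ_of_hasDerivWithinAt
    (φ := fun t ↦ 16 * D 0 (x + 1 * t) + 16 * D 0 (x + -1 * t)
      + -1 * D 0 (x + 2 * t) + -1 * D 0 (x + -2 * t) - 12 * D 2 x * t ^ 2 - 30 * D 0 x) _
    (fun t ht ↦ (((hstencil 0 (by norm_num) 16 16 (-1) (-1) t ht).sub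
      ((hasDerivAt_pow 2 t).hasDerivWithinAt.const_mul (12 * D 2 x))).sub_const _).congr_deriv
      (by push_cast; ring))
    (by simp only [mul_zero, add_zero]; ring) b1 h ⟨hh.le, le_rfl⟩
  have hfinal : (-D 0 (x - 2 * h) + 16 * D 0 (x - h) - 30 * D 0 x + 16 * D 0 (x + h)
      - D 0 (x + 2 * h)) / (12 * h ^ 2) - D 2 x =
      (16 * D 0 (x + 1 * h) + 16 * D 0 (x + -1 * h)
      + -1 * D 0 (x + 2 * h) + -1 * D 0 (x + -2 * h) - 12 * D 2 x * h ^ 2 - 30 * D 0 x)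
        / (12 * h ^ 2) := by
    rw [show x + 1 * h = x + h by ring, show x + -1 * h = x - h by ring,
      show x + -2 * h = x - 2 * h by ring]
    field_simp
    ring
  rw [hfinal, abs_div, abs_of_pos (by positivity : 0 < 12 * h ^ 2),
    div_le_iff₀ (by positivity)]
  refine b0.trans_eq ?_
  push_cast
  ring
end
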